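/- For a sequence of epimorphisms between finitely generated groups, the induced sequence of Hom-sets into a fixed free group eventually stabilizes: let F = FreeGroup β be a free group, let (Gₙ) be a sequence of finitely generated groups, and let fₙ : Gₙ → Gₙ₊₁ be a surjective group homomorphism for each n. Then there exists N such that for all n ≥ N the precomposition map Hom(Gₙ₊₁, F) → Hom(Gₙ, F), sending φ to φ ∘ fₙ, is a bijection. -/

import Mathlib

open Polynomial in
/-- The rank-one square-zero matrix `X • v wᵀ` with `v = (1, s)` and `w = (-s, 1)`. -/
noncomputable def shearMatrix {R : Type*} [CommRing R] (s : R) : Matrix (Fin 2) (Fin 2) R[X] :=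
  (X : R[X]) • !![-C s, 1; -(C s * C s), C s]

theorem shearMatrix_mul_self {R : Type*} [CommRing R] (s : R) :
    shearMatrix s * shearMatrix s = 0 := by
  ext i j
  fin_cases i <;> fin_cases j <;> simp [shearMatrix, Matrix.mul_apply, Fin.sum_univ_two] <;> ring_nf

/-- The one-parameter group `n ↦ 1 + n • N` attached to a square-zero element `N`. -/
def unipotentHom {A : Type*} [Ring A] (N : A) (hN : N * N = 0) : Multiplicative ℤ →* A where
  toFun n := 1 + n.toAdd • N
  map_one' := by simp
  map_mul' m n := by
    simp only [toAdd_mul, mul_add, add_mul, one_mul, mul_one, smul_mul_smul_comm, hN, smul_zero,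
      add_smul]
    abel

open Polynomial in
/-- The linear automorphism `1 + shearMatrix s` of `R[X]²`. -/
noncomputable def shear {R : Type*} [CommRing R] (s : R) :
    (Module.End R[X] (Fin 2 → R[X]))ˣ :=
  (unipotentHom (Matrix.toLinAlgEquiv' (shearMatrix s))
    (by rw [← map_mul, shearMatrix_mul_self, map_zero])).toHomUnits (Multiplicative.ofAdd 1)

open Polynomial in
theorem shear_zpow_smul {R : Type*} [CommRing R] (s : R) (n : ℤ) (u : Fin 2 → R[X]) :
    (shear s ^ n) • u =
      ![u 0 + (n : R[X]) * X * (u 1 - C s * u 0),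
        u 1 + (n : R[X]) * X * (C s * (u 1 - C s * u 0))] := by
  rw [shear, ← map_zpow, ← ofAdd_zsmul, smul_eq_mul, mul_one, Units.smul_def,
    MonoidHom.coe_toHomUnits]
  ext1 i
  fin_cases i <;> simp [unipotentHom, shearMatrix, dotProduct, Fin.sum_univ_two,
    Matrix.toLinAlgEquiv'_apply] <;> ring

open Polynomial in
/-- Vectors whose leading coefficient vector is proportional to `(1, s)`. -/
def leadingCone {R : Type*} [CommRing R] (s : R) : Set (Fin 2 → R[X]) :=
  {u | (u 1 - C s * u 0).degree < (u 0).degree}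

open Polynomial in
theorem degree_sub_C_mul_of_mem_leadingCone {R : Type*} [CommRing R] [IsDomain R] {s r : R}
    (hsr : s ≠ r) {u : Fin 2 → R[X]} (hu : u ∈ leadingCone r) :
    (u 1 - C s * u 0).degree = (u 0).degree := by
  have h : u 1 - C s * u 0 = (u 1 - C r * u 0) + C (r - s) * u 0 := by
    rw [C_sub]; ring
  have hd : (C (r - s) * u 0).degree = (u 0).degree := by
    rw [degree_mul, degree_C (sub_ne_zero.2 hsr.symm), zero_add]
  rw [h, degree_add_eq_right_of_degree_lt (by rw [hd]; exact hu), hd]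

theorem disjoint_leadingCone {R : Type*} [CommRing R] [IsDomain R] {s r : R} (hsr : s ≠ r) :
    Disjoint (leadingCone s) (leadingCone r) := by
  rw [Set.disjoint_left]
  intro u hs hr
  exact (degree_sub_C_mul_of_mem_leadingCone hsr hr).not_lt hs

open Polynomial in
theorem shear_zpow_smul_mem_leadingCone {R : Type*} [CommRing R] [IsDomain R] [CharZero R]
    {s r : R} (hsr : s ≠ r) {n : ℤ} (hn : n ≠ 0) {u : Fin 2 → R[X]} (hu : u ∈ leadingCone r) :
    (shear s ^ n) • u ∈ leadingCone s := by
  have hd := degree_sub_C_mul_of_mem_leadingCone hsr hu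
  have hu0 : u 0 ≠ 0 := by
    rintro h0
    simp [leadingCone, h0] at hu
  have hlt : (u 0).degree < ((n : R[X]) * X * (u 1 - C s * u 0)).degree := by
    have hnd : ((n : R[X])).degree = 0 := by
      rw [← C_eq_intCast, degree_C (Int.cast_ne_zero.2 hn)]
    rw [degree_mul, degree_mul, hd, hnd, degree_X, zero_add, degree_eq_natDegree hu0]
    norm_cast
    omega
  have hsub : u 1 + (n : R[X]) * X * (C s * (u 1 - C s * u 0))
      - C s * (u 0 + (n : R[X]) * X * (u 1 - C s * u 0)) = u 1 - C s * u 0 := by ring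
  rw [shear_zpow_smul]
  simp only [leadingCone, Set.mem_ofPred_eq, Matrix.cons_val_zero, Matrix.cons_val_one]
  rw [hsub, hd, degree_add_eq_right_of_degree_lt hlt]
  exact hlt

open scoped Pointwise in
theorem lift_shear_injective {ι R : Type} [Nontrivial ι] [CommRing R] [IsDomain R] [CharZero R]
    {s : ι → R} (hs : Function.Injective s) :
    Function.Injective (FreeGroup.lift fun i => shear (s i)) := by
  have hfactor : FreeGroup.lift (fun i => shear (s i)) =
      (Monoid.CoprodI.lift fun i => FreeGroup.lift fun _ : Unit => shear (s i)).comp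
        (@freeGroupEquivCoprodI ι).toMonoidHom := by
    ext1 i
    simp
  rw [hfactor, MonoidHom.coe_comp]
  refine Function.Injective.comp ?_ (MulEquiv.injective freeGroupEquivCoprodI)
  refine Monoid.CoprodI.lift_injective_of_ping_pong _ ?_ (fun i => leadingCone (s i)) ?_ ?_ ?_
  · right
    refine ⟨Classical.arbitrary ι, ?_⟩
    rw [FreeGroup.freeGroupUnitEquivInt.cardinal_eq, Cardinal.mk_denumerable]
    exact Cardinal.natCast_le_aleph0
  · intro i
    exact ⟨![1, Polynomial.C (s i)], by simp [leadingCone]⟩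
  · intro i j hij
    exact disjoint_leadingCone (hs.ne hij)
  · intro i j hij
    refine FreeGroup.freeGroupUnitEquivInt.forall_congr_left.mpr ?_
    intro n hn1
    have hn : n ≠ 0 := by
      rintro rfl
      exact hn1 (by simp [FreeGroup.freeGroupUnitEquivInt])
    change FreeGroup.lift (fun _ => shear (s i)) (FreeGroup.of () ^ n) • leadingCone (s j) ⊆
      leadingCone (s i)
    rw [map_zpow, FreeGroup.lift_apply_of]
    rintro _ ⟨u, hu, rfl⟩
    exact shear_zpow_smul_mem_leadingCone (hs.ne hij) hn hu

/-- Free groups are linear: they embed in the `2 × 2` matrices over some commutative ring. -/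
theorem FreeGroup.exists_injective_matrix (β : Type) :
    ∃ (S : Type) (_ : CommRing S) (ρ : FreeGroup β →* Matrix (Fin 2) (Fin 2) S),
      Function.Injective ρ := by
  let R := MvPolynomial (β ⊕ Bool) ℤ
  refine ⟨Polynomial R, inferInstance,
    (Matrix.toLinAlgEquiv' (R := Polynomial R) (n := Fin 2)).symm.toMulEquiv.toMonoidHom.comp
    ((Units.coeHom _).comp ((FreeGroup.lift fun i => shear (MvPolynomial.X i : R)).comp
      (FreeGroup.map Sum.inl))), ?_⟩
  have : Nontrivial (β ⊕ Bool) := ⟨Sum.inr true, Sum.inr false, by simp⟩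
  exact (Matrix.toLinAlgEquiv' (R := Polynomial R) (n := Fin 2)).symm.injective.comp
    (Units.val_injective.comp ((lift_shear_injective (MvPolynomial.X_injective)).comp
      (FreeGroup.map_injective Sum.inl_injective)))

/-- The matrix of indeterminates attached to each letter, extended multiplicatively to words. -/
noncomputable def genericMatrix (α m : Type*) [Fintype m] [DecidableEq m] :
    FreeMonoid α →* Matrix m m (MvPolynomial (α × m × m) ℤ) :=
  FreeMonoid.lift fun a => Matrix.of fun i j => MvPolynomial.X (a, i, j)

/-- The ideal of equations satisfied by the `m × m` matrix representations that send every word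
in the kernel of `π` to `1`. -/
noncomputable def relationIdeal {α H : Type*} [Monoid H] (m : Type*) [Fintype m] [DecidableEq m]
    (π : FreeMonoid α →* H) : Ideal (MvPolynomial (α × m × m) ℤ) :=
  Ideal.span {p | ∃ w, π w = 1 ∧ ∃ i j, p = (genericMatrix α m w - 1) i j}

theorem relationIdeal_mono {α H K m : Type*} [Monoid H] [Monoid K] [Fintype m] [DecidableEq m]
    (π : FreeMonoid α →* H) (f : H →* K) :
    relationIdeal m π ≤ relationIdeal m (f.comp π) := by
  refine Ideal.span_mono ?_
  rintro p ⟨w, hw, i, j, rfl⟩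
  exact ⟨w, by simp [hw], i, j, rfl⟩

theorem map_eq_one_of_relationIdeal_le {α H K m S : Type*} [Monoid H] [Monoid K] [Fintype m]
    [DecidableEq m] [CommRing S] (π : FreeMonoid α →* H) (π' : FreeMonoid α →* K)
    (hle : relationIdeal m π' ≤ relationIdeal m π) (ψ : H →* Matrix m m S)
    {w : FreeMonoid α} (hw : π' w = 1) : ψ (π w) = 1 := by
  let e : MvPolynomial (α × m × m) ℤ →+* S :=
    MvPolynomial.eval₂Hom (Int.castRingHom S) fun x => ψ (π (FreeMonoid.of x.1)) x.2.1 x.2.2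
  have hgen : ∀ v, e.mapMatrix (genericMatrix α m v) = ψ (π v) := by
    intro v
    have : (e.mapMatrix (m := m)).toMonoidHom.comp (genericMatrix α m) = ψ.comp π := by
      ext a i j
      simp [genericMatrix, e]
    exact DFunLike.congr_fun this v
  have hker : relationIdeal m π ≤ RingHom.ker e := by
    refine Ideal.span_le.2 ?_
    rintro p ⟨v, hv, i, j, rfl⟩
    have h : e.mapMatrix (genericMatrix α m v - 1) = 0 := by
      rw [map_sub, hgen, hv, map_one, map_one, sub_self]
    exact congrFun (congrFun h i) j
  rw [← hgen, ← sub_eq_zero, ← map_one e.mapMatrix, ← map_sub]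
  ext i j
  exact hker (hle (Ideal.subset_span ⟨w, hw, i, j, rfl⟩))

/-- The composite of a sequence of homomorphisms, precomposed with a homomorphism to the
first term. -/
def compSequence {M : Type*} [Monoid M] {G : ℕ → Type*} [∀ n, Monoid (G n)]
    (f : ∀ n, G n →* G (n + 1)) (π : M →* G 0) : ∀ n, M →* G n
  | 0 => π
  | n + 1 => (f n).comp (compSequence f π n)

theorem compSequence_surjective {M : Type*} [Monoid M] {G : ℕ → Type*} [∀ n, Monoid (G n)]
    {f : ∀ n, G n →* G (n + 1)} (hf : ∀ n, Function.Surjective (f n)) {π : M →* G 0}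
    (hπ : Function.Surjective π) : ∀ n, Function.Surjective (compSequence f π n)
  | 0 => hπ
  | n + 1 => (hf n).comp (compSequence_surjective hf hπ n)

theorem hom_sets_stabilize (β : Type) (G : ℕ → Type) [∀ n, Group (G n)]
    (hFG : ∀ n, Group.FG (G n))
    (f : ∀ n, G n →* G (n + 1)) (hf : ∀ n, Function.Surjective (f n)) :
    ∃ N : ℕ, ∀ n ≥ N,
      Function.Bijective
        (fun φ : G (n + 1) →* FreeGroup β => φ.comp (f n)) := by
  obtain ⟨S, _, ρ, hρ⟩ := FreeGroup.exists_injective_matrix β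
  obtain ⟨α, _, π, hπ⟩ := Monoid.fg_iff_exists_freeGroup_hom_surjective_finite.1
    (Group.fg_iff_monoid_fg.1 (hFG 0))
  let I : ℕ →o Ideal (MvPolynomial (α × Fin 2 × Fin 2) ℤ) :=
    ⟨fun n => relationIdeal (Fin 2) (compSequence f π n),
      monotone_nat_of_le_succ fun n => relationIdeal_mono _ (f n)⟩
  obtain ⟨N, hN⟩ := monotone_stabilizes_iff_noetherian.2
    (inferInstance : IsNoetherianRing (MvPolynomial (α × Fin 2 × Fin 2) ℤ)) I
  refine ⟨N, fun n hn => ⟨fun φ ψ h => (MonoidHom.cancel_right (hf n)).1 h, fun φ => ?_⟩⟩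
  have hle : I (n + 1) ≤ I n := by rw [← hN n hn, ← hN (n + 1) (by omega)]
  have hker : (f n).ker ≤ φ.ker := by
    intro g hg
    obtain ⟨w, rfl⟩ := compSequence_surjective hf hπ n g
    apply hρ
    rw [map_one]
    exact map_eq_one_of_relationIdeal_le _ (compSequence f π (n + 1)) hle (ρ.comp φ) hg
  exact ⟨(f n).liftOfSurjective (hf n) ⟨φ, hker⟩,
    MonoidHom.liftOfRightInverse_comp _ _ _ ⟨φ, hker⟩⟩
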